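/- There exists a constant C₁ > 0 such that for every m ≥ 1, with n = 2m+1, Σ_{x ∈ X_n(3)} |h₁(x)| ≤ C₁^m / m!, where X_n(3) is the (finite) set of admissible walks from −n to n all of whose steps lie in {−2, +4} and which have exactly three steps equal to −2, and h₁(x) = ∏_{t=1}^{ν} (n² − j(t)²)^{-1}. -/

import Mathlib

/-- The vertex `j(t) = -n + Σ_{i=1}^t x(i)` of a walk `l` from `-n` to `n`. -/
def vertex (n : ℤ) (l : List ℤ) (t : ℕ) : ℤ := -n + (l.take t).sum

/-- A walk from `-n` to `n`: a sequence of `ν + 1 ≥ 2` nonzero even steps summing to `2n`. -/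
def IsWalk (n : ℤ) (l : List ℤ) : Prop :=
  2 ≤ l.length ∧ (∀ s ∈ l, s ≠ 0 ∧ Even s) ∧ l.sum = 2 * n

/-- An admissible walk: the intermediate vertices `j(t)` (`1 ≤ t ≤ ν`) avoid `±n`. -/
def IsAdmissibleWalk (n : ℤ) (l : List ℤ) : Prop :=
  IsWalk n l ∧ ∀ t : ℕ, 1 ≤ t → t + 1 ≤ l.length →
    vertex n l t ≠ n ∧ vertex n l t ≠ -n

/-- `h₁(x) = ∏_{t=1}^{ν} (n² - j(t)²)⁻¹`, as a real number. -/
noncomputable def h1 (n : ℤ) (l : List ℤ) : ℝ :=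
  ∏ t ∈ Finset.Icc 1 (l.length - 1), ((n : ℝ) ^ 2 - ((vertex n l t : ℤ) : ℝ) ^ 2)⁻¹

lemma sum_aux (l : List ℤ) (h : ∀ s ∈ l, s = -2 ∨ s = 4) :
    l.sum = 4 * (l.length : ℤ) - 6 * (l.count (-2) : ℤ) := by
  induction l with
  | nil => simp
  | cons a t ih =>
    have ih' := ih (fun s hs => h s (List.mem_cons_of_mem _ hs))
    rcases h a List.mem_cons_self with rfl | rfl
    · simp [ih']; ring
    · simp [ih']; ring

lemma factor_aux (m : ℕ) (hm : 1 ≤ m) (v : ℤ) (h1 : v ≠ 2 * (m : ℤ) + 1)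
    (h2 : v ≠ -(2 * (m : ℤ) + 1)) : (m : ℤ) ≤ |(2 * (m : ℤ) + 1) ^ 2 - v ^ 2| := by
  have hm' : (1 : ℤ) ≤ m := by exact_mod_cast hm
  rcases lt_or_ge (2 * (m : ℤ) + 1) v with h | h
  · refine le_trans ?_ (neg_le_abs _)
    nlinarith
  rcases lt_or_ge v (-(2 * (m : ℤ) + 1)) with h' | h'
  · refine le_trans ?_ (neg_le_abs _)
    nlinarith
  · refine le_trans ?_ (le_abs_self _)
    have a : v + 1 ≤ 2 * (m : ℤ) + 1 := by omega
    have b : -(2 * (m : ℤ) + 1) + 1 ≤ v := by omega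
    nlinarith

lemma h1_aux (m : ℕ) (hm : 1 ≤ m) (l : List ℤ) (hl : IsAdmissibleWalk (2 * (m : ℤ) + 1) l)
    (hlen : l.length = m + 5) : |h1 (2 * (m : ℤ) + 1) l| ≤ 1 / (Nat.factorial m : ℝ) := by
  have hm' : (1 : ℝ) ≤ m := by exact_mod_cast hm
  have key : |h1 (2 * (m : ℤ) + 1) l| ≤ ∏ t ∈ Finset.Icc 1 (l.length - 1), ((m : ℝ)⁻¹) := by
    unfold h1
    rw [Finset.abs_prod]
    refine Finset.prod_le_prod (fun _ _ => abs_nonneg _) ?_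
    intro t ht
    rw [Finset.mem_Icc] at ht
    obtain ⟨ha, hb⟩ := hl.2 t ht.1 (by omega)
    have := factor_aux m hm _ ha hb
    rw [abs_inv]
    refine inv_anti₀ (by linarith) ?_
    exact_mod_cast this
  refine key.trans ?_
  rw [Finset.prod_const, Nat.card_Icc, hlen, inv_pow, ← one_div]
  refine one_div_le_one_div_of_le (by positivity) ?_
  calc (Nat.factorial m : ℝ) ≤ (m : ℝ) ^ m := by exact_mod_cast Nat.factorial_le_pow m
    _ ≤ _ := pow_le_pow_right₀ hm' (by omega)

/-- The upper estimate (13.2): there is a constant `C₁ > 0` such that for every `m ≥ 1`, with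
`n = 2m + 1`, the sum of `|h₁(x)|` over all admissible walks from `-n` to `n` with steps in
`{-2, +4}` having exactly three steps equal to `-2` is at most `C₁^m / m!`. -/
theorem B3_upper_estimate :
    ∃ C₁ : ℝ, 0 < C₁ ∧ ∀ m : ℕ, 1 ≤ m →
      (∑ᶠ (l : List ℤ)
          (_ : IsAdmissibleWalk (2 * (m : ℤ) + 1) l ∧ (∀ s ∈ l, s = -2 ∨ s = 4) ∧
                l.count (-2) = 3),
          |h1 (2 * (m : ℤ) + 1) l|)
        ≤ C₁ ^ m / (Nat.factorial m : ℝ) := by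
  classical
  refine ⟨64, by norm_num, fun m hm => ?_⟩
  have hlen : ∀ l : List ℤ, (IsAdmissibleWalk (2 * (m : ℤ) + 1) l ∧
      (∀ s ∈ l, s = -2 ∨ s = 4) ∧ l.count (-2) = 3) → l.length = m + 5 := by
    rintro l ⟨h, h4, h3⟩
    have e := sum_aux l h4
    rw [h.1.2.2, h3] at e
    push_cast at e
    omega
  let S : Finset (List ℤ) := (Finset.univ : Finset (Fin (m + 5) → Bool)).image
    (fun f => List.ofFn (fun i => if f i then (-2 : ℤ) else 4))
  have hS : S.card ≤ 2 ^ (m + 5) := by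
    refine Finset.card_image_le.trans ?_
    simp
  rw [finsum_eq_sum_of_support_subset (s := S)]
  · have hb : ∀ l ∈ S, (∑ᶠ (_ : IsAdmissibleWalk (2 * (m : ℤ) + 1) l ∧
        (∀ s ∈ l, s = -2 ∨ s = 4) ∧ l.count (-2) = 3), |h1 (2 * (m : ℤ) + 1) l|)
        ≤ 1 / (Nat.factorial m : ℝ) := by
      intro l _
      rw [finsum_eq_if]
      split_ifs with h
      · exact h1_aux m hm l h.1 (hlen l h)
      · positivity
    refine (Finset.sum_le_card_nsmul _ _ _ hb).trans ?_
    rw [nsmul_eq_mul, mul_one_div]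
    gcongr
    calc (S.card : ℝ) ≤ 2 ^ (m + 5) := by exact_mod_cast hS
      _ ≤ 2 ^ (6 * m) := pow_le_pow_right₀ (by norm_num) (by omega)
      _ = 64 ^ m := by rw [pow_mul]; norm_num
  · intro l hl
    rw [Function.mem_support, finsum_eq_if] at hl
    split_ifs at hl with h
    · have hL := hlen l h
      simp only [S, Finset.coe_image, Finset.coe_univ, Set.image_univ, Set.mem_range]
      refine ⟨fun i => decide (l[(i : ℕ)]'(by omega) = -2), ?_⟩
      refine List.ext_getElem (by simp [hL]) ?_
      intro i h₁ h₂
      have := h.2.1 _ (List.getElem_mem h₂)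
      rw [List.getElem_ofFn]
      rcases this with e | e <;> simp [e]
    · exact absurd rfl hl
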